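/- arXiv:1611.10058 — 2 statements merged into one kernel-verified Lean document; each statement's English description precedes it below -/
import Mathlib

section
/- Let S be a set of 2n points in convex position in the plane, n ≥ 2. If F_1, F_2, …, F_n are n pairwise edge-disjoint non-crossing perfect matchings on S, then their union (as a geometric graph) is exactly the graph C_{2n,n}; that is, labeling S as v_0, …, v_{2n−1} in cyclic order, the union of the F_i consists precisely of all edges v_kv_l with k + l odd modulo 2n. -/
noncomputable section

open Classical

/-- A point of the plane. -/
abbrev Pt : Type := ℝ × ℝ

/-- The signed-area determinant of the ordered triple `(p, q, r)`; it is positive iff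
`r` lies strictly on the left of the directed line from `p` to `q`. -/
def det2 (p q r : Pt) : ℝ :=
  (q.1 - p.1) * (r.2 - p.2) - (q.2 - p.2) * (r.1 - p.1)

/-- A set of points is in general position if no three distinct points of it are collinear. -/
def GenPos (S : Set Pt) : Prop :=
  ∀ p ∈ S, ∀ q ∈ S, ∀ r ∈ S, p ≠ q → p ≠ r → q ≠ r →
    ¬ Collinear ℝ ({p, q, r} : Set Pt)

/-- `e` is a straight-line edge with (two distinct) endpoints in `S`,
represented as the two-element set of its endpoints. -/
def IsEdgeOn (S : Set Pt) (e : Set Pt) : Prop :=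
  ∃ a b : Pt, a ≠ b ∧ a ∈ S ∧ b ∈ S ∧ e = {a, b}

/-- `F` is a perfect matching on the point set `S`: every edge of `F` joins two points
of `S`, and every point of `S` lies on exactly one edge of `F`. -/
def IsPerfectMatching (S : Set Pt) (F : Set (Set Pt)) : Prop :=
  (∀ e ∈ F, IsEdgeOn S e) ∧ ∀ p ∈ S, ∃! e, e ∈ F ∧ p ∈ e

/-- The set of points interior to the edge `e` (the open segment between its endpoints). -/
def openSeg (e : Set Pt) : Set Pt :=
  {x | ∃ a ∈ e, ∃ b ∈ e, a ≠ b ∧ x ∈ openSegment ℝ a b}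

/-- A set of edges is non-crossing if no two distinct edges have a common point
interior to both. -/
def NonCrossing (E : Set (Set Pt)) : Prop :=
  ∀ e ∈ E, ∀ f ∈ E, e ≠ f → openSeg e ∩ openSeg f = ∅

/-- A geometric graph (given by its edge set `E`) is triangle-free if no three pairwise
distinct points are pairwise joined by edges of `E`. -/
def TriangleFree (E : Set (Set Pt)) : Prop :=
  ¬ ∃ p q r : Pt, p ≠ q ∧ p ≠ r ∧ q ≠ r ∧
      ({p, q} : Set Pt) ∈ E ∧ ({q, r} : Set Pt) ∈ E ∧ ({p, r} : Set Pt) ∈ E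

/-- `v` lists `m` points in convex position, labeled in (anticlockwise) cyclic order:
for every `i`, all points other than `v i` and `v (i+1)` lie strictly on the left of the
directed line from `v i` to `v (i+1)`. -/
def ConvexCyclic {m : ℕ} (v : ZMod m → Pt) : Prop :=
  ∀ i j : ZMod m, j ≠ i → j ≠ i + 1 → 0 < det2 (v i) (v (i + 1)) (v j)

/-- The edge set of the convex geometric graph `C_{2n,n}` on the convex-position points
`v 0, …, v (2n−1)`: all edges `v k – v l` with `k + l` odd modulo `2n`. -/
def Cedges (n : ℕ) (v : ZMod (2 * n) → Pt) : Set (Set Pt) :=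
  {e | ∃ k l : ZMod (2 * n), (∃ t : ZMod (2 * n), k + l = 2 * t + 1) ∧ e = {v k, v l}}

theorem det2_cyc (p q r : Pt) : det2 p q r = det2 q r p := by
  unfold det2; ring

theorem cross_exists (a b c d : Pt) (h1 : 0 < det2 a b c) (h2 : 0 < det2 a c d)
    (h3 : 0 < det2 a b d) (h4 : 0 < det2 b c d) :
    ∃ x, x ∈ openSegment ℝ a c ∧ x ∈ openSegment ℝ b d := by
  have hs : det2 b c d + det2 a b d = det2 a c d + det2 a b c := by unfold det2; ring
  have hD : 0 < det2 a c d + det2 a b c := by positivity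
  refine ⟨(det2 a c d / (det2 a c d + det2 a b c)) • b +
    (det2 a b c / (det2 a c d + det2 a b c)) • d, ?_, ?_⟩
  · refine ⟨det2 b c d / (det2 a c d + det2 a b c), det2 a b d / (det2 a c d + det2 a b c),
      by positivity, by positivity, ?_, ?_⟩
    · rw [← add_div, hs, div_self hD.ne']
    · ext
      · simp only [Prod.fst_add, Prod.smul_fst, smul_eq_mul]
        field_simp
        unfold det2; ring
      · simp only [Prod.snd_add, Prod.smul_snd, smul_eq_mul]
        field_simp
        unfold det2; ring
  · refine ⟨_, _, by positivity, by positivity, ?_, rfl⟩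
    rw [← add_div, div_self hD.ne']

theorem cast_ne {m : ℕ} (k : ZMod m) {s t : ℕ} (hs : s < m) (ht : t < m) (h : s ≠ t) :
    k + (s : ZMod m) ≠ k + (t : ZMod m) := by
  intro h'
  have := add_left_cancel h'
  rw [ZMod.natCast_eq_natCast_iff'] at this
  rw [Nat.mod_eq_of_lt hs, Nat.mod_eq_of_lt ht] at this
  exact h this

theorem tri0 {m : ℕ} (v : ZMod m → Pt) (hv : ConvexCyclic v) (k : ZMod m) (s t : ℕ)
    (hs : 0 < s) (hst : s < t) (ht : t < m) :
    0 < det2 (v k) (v (k + s)) (v (k + t)) := by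
  have h1 : ∀ r : ℕ, 1 < r → r < m → 0 < det2 (v k) (v (k + (1 : ℕ))) (v (k + r)) := by
    intro r hr hrm
    have := hv k (k + r) ?_ ?_
    · simpa using this
    · have := cast_ne k (s := r) (t := 0) hrm (by omega) (by omega)
      simpa using this
    · have := cast_ne k (s := r) (t := 1) hrm (by omega) (by omega)
      simpa using this
  have h2 : ∀ r : ℕ, 0 < r → r + 1 < m →
      0 < det2 (v k) (v (k + r)) (v (k + (r + 1 : ℕ))) := by
    intro r hr hrm
    rw [det2_cyc]
    have := hv (k + r) k ?_ ?_
    · push_cast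
      rw [← add_assoc]; exact this
    · have := cast_ne k (s := 0) (t := r) (by omega) (by omega) (by omega)
      simpa using this
    · have := cast_ne k (s := 0) (t := r + 1) (by omega) (by omega) (by omega)
      simpa [add_assoc] using this
  rcases Nat.lt_or_ge 1 s with hs1 | hs1
  · induction t, hst using Nat.le_induction with
    | base => exact h2 s hs ht
    | succ t hst ih =>
      have a1 := ih (by omega)
      have a2 := h1 s hs1 (by omega)
      have a3 := h1 t (by omega) (by omega)
      have a4 := h1 (t + 1) (by omega) (by omega)
      have a5 := h2 t (by omega) (by omega)
      generalize v (k + (t + 1 : ℕ)) = z at *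
      generalize v (k + (t : ℕ)) = y at *
      generalize v (k + (1 : ℕ)) = w at *
      generalize v (k + (s : ℕ)) = x at *
      generalize v k = o at *
      have key : det2 o w y * det2 o x z = det2 o w x * det2 o y z + det2 o w z * det2 o x y := by
        unfold det2; ring
      have : 0 < det2 o w y * det2 o x z := by rw [key]; positivity
      exact (pos_iff_pos_of_mul_pos this).1 a3
  · have : s = 1 := by omega
    subst this
    exact h1 t hst ht

theorem tri {m : ℕ} (v : ZMod m → Pt) (hv : ConvexCyclic v) (k : ZMod m) (r s t : ℕ)
    (hr : r < s) (hst : s < t) (ht : t < m) :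
    0 < det2 (v (k + r)) (v (k + s)) (v (k + t)) := by
  have := tri0 v hv (k + r) (s - r) (t - r) (by omega) (by omega) (by omega)
  rw [add_assoc, add_assoc, ← Nat.cast_add, ← Nat.cast_add] at this
  rwa [show r + (s - r) = s by omega, show r + (t - r) = t by omega] at this

theorem v_inj {m : ℕ} (hm : 3 ≤ m) (v : ZMod m → Pt) (hv : ConvexCyclic v) :
    Function.Injective v := by
  have : NeZero m := ⟨by omega⟩
  intro a b hab
  by_contra hne
  have h2 : (1 : ZMod m) ≠ 0 := by
    have := cast_ne (0 : ZMod m) (s := 1) (t := 0) (by omega) (by omega) (by omega)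
    simpa using this
  by_cases hb : b = a + 1
  · have := hv a (a + (2 : ℕ)) ?_ ?_
    · rw [← hb, ← hab] at this
      simp [det2] at this
    · have := cast_ne a (s := 2) (t := 0) (by omega) (by omega) (by omega)
      simpa using this
    · have := cast_ne a (s := 2) (t := 1) (by omega) (by omega) (by omega)
      simpa using this
  · have := hv a b (fun h => hne h.symm) hb
    rw [← hab] at this
    simp [det2] at this

theorem pm_partner {m : ℕ} (v : ZMod m → Pt) (hinj : Function.Injective v)
    (F : Set (Set Pt)) (hpm : IsPerfectMatching (Set.range v) F) :
    ∃ σ : ZMod m → ZMod m, (∀ k, ({v k, v (σ k)} : Set Pt) ∈ F) ∧ (∀ k, σ k ≠ k) ∧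
      (∀ k l, ({v k, v l} : Set Pt) ∈ F → l = σ k) := by
  have h : ∀ k, ∃ l, ({v k, v l} : Set Pt) ∈ F := by
    intro k
    obtain ⟨e, ⟨he, hk⟩, -⟩ := hpm.2 (v k) ⟨k, rfl⟩
    obtain ⟨a, b, hab, ⟨i, rfl⟩, ⟨j, rfl⟩, rfl⟩ := hpm.1 e he
    rcases hk with hk | hk
    · exact ⟨j, by rw [hk]; exact he⟩
    · rw [Set.mem_singleton_iff] at hk
      exact ⟨i, by rw [hk, Set.pair_comm]; exact he⟩
  have hne : ∀ k l, ({v k, v l} : Set Pt) ∈ F → l ≠ k := by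
    rintro k l he rfl
    obtain ⟨a, b, hab, -, -, h⟩ := hpm.1 _ he
    have ha : a ∈ ({v l, v l} : Set Pt) := by rw [h]; simp
    have hb : b ∈ ({v l, v l} : Set Pt) := by rw [h]; simp
    simp at ha hb
    exact hab (ha.trans hb.symm)
  choose σ hσ using h
  refine ⟨σ, hσ, fun k => hne k _ (hσ k), fun k l hkl => ?_⟩
  have := (hpm.2 (v k) ⟨k, rfl⟩).unique ⟨hkl, by simp⟩ ⟨hσ k, by simp⟩
  have hl : v l ∈ ({v k, v (σ k)} : Set Pt) := by rw [← this]; simp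
  rcases hl with hl | hl
  · exact absurd (hinj hl) (hne k l hkl)
  · exact hinj hl

theorem odd_of_nc {m : ℕ} (hm : 3 ≤ m) (v : ZMod m → Pt) (hv : ConvexCyclic v)
    (F : Set (Set Pt)) (hnc : NonCrossing F) (σ : ZMod m → ZMod m)
    (h1 : ∀ k, ({v k, v (σ k)} : Set Pt) ∈ F) (h2 : ∀ k, σ k ≠ k)
    (h3 : ∀ k l, ({v k, v l} : Set Pt) ∈ F → l = σ k) (k : ZMod m) :
    Odd (σ k - k).val := by
  have : NeZero m := ⟨by omega⟩
  have hinj := v_inj hm v hv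
  have hinv : ∀ k, σ (σ k) = k := by
    intro k
    exact (h3 (σ k) k (by rw [Set.pair_comm]; exact h1 k)).symm
  -- work with offsets
  set τ : ℕ → ℕ := fun s => (σ (k + s) - k).val with hτ
  have hτlt : ∀ s, τ s < m := fun s => ZMod.val_lt _
  have hτc : ∀ s, k + (τ s : ZMod m) = σ (k + s) := by
    intro s; simp [hτ]
  have hττ : ∀ s, s < m → τ (τ s) = s := by
    intro s hs
    simp only [hτ]
    have := hτc s
    simp only [hτ] at this
    rw [this, hinv]
    simp [ZMod.val_natCast, Nat.mod_eq_of_lt hs]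
  have hτne : ∀ s, τ s ≠ s := by
    intro s h
    have := hτc s
    rw [h] at this
    exact h2 _ this.symm
  have hF : ∀ s : ℕ, ({v (k + s), v (k + (τ s : ZMod m))} : Set Pt) ∈ F := by
    intro s; rw [hτc]; exact h1 _
  have h0 : τ 0 = (σ k - k).val := by simp [hτ]
  rw [← h0]
  have ht0 : 0 < τ 0 := Nat.pos_of_ne_zero (hτne 0)
  have hmem : ∀ s, 0 < s → s < τ 0 → 0 < τ s ∧ τ s < τ 0 := by
    intro s hs hst
    have hsm : s < m := hst.trans (hτlt 0)
    have e := hττ s hsm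
    have e0 := hττ 0 (by omega)
    have hn0 : τ s ≠ 0 := by intro h; rw [h] at e; omega
    have hnt : τ s ≠ τ 0 := by intro h; rw [h, e0] at e; omega
    refine ⟨by omega, ?_⟩
    by_contra hcon
    have hgt : τ 0 < τ s := by omega
    have hr := hτlt s
    obtain ⟨x, hx1, hx2⟩ := cross_exists (v (k + (0 : ℕ))) (v (k + s)) (v (k + (τ 0 : ℕ)))
      (v (k + (τ s : ℕ))) (tri v hv k _ _ _ hs hst (by omega)) (tri v hv k _ _ _ ht0 hgt hr)
      (tri v hv k _ _ _ hs (by omega) hr) (tri v hv k _ _ _ hst hgt hr)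
    have hA := hF 0
    have hB := hF s
    have hne : ({v (k + (0 : ℕ)), v (k + (τ 0 : ZMod m))} : Set Pt) ≠
        {v (k + s), v (k + (τ s : ZMod m))} := by
      intro h
      have : v (k + s) ∈ ({v (k + (0 : ℕ)), v (k + (τ 0 : ZMod m))} : Set Pt) := by
        rw [h]; simp
      rcases this with h | h
      · exact cast_ne k hsm (by omega) (by omega) (hinj h)
      · exact cast_ne k hsm (hτlt 0) (by omega) (hinj h)
    have hemp := hnc _ hA _ hB hne
    have : x ∈ (∅ : Set Pt) := by
      rw [← hemp]
      refine ⟨⟨_, by simp, _, by simp, ?_, hx1⟩, ⟨_, by simp, _, by simp, ?_, hx2⟩⟩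
      · intro h
        exact cast_ne k (by omega) (hτlt 0) (by omega) (hinj h)
      · intro h
        exact cast_ne k hsm hr (by omega) (hinj h)
    exact this
  have hsum : ∑ s ∈ Finset.Ioo 0 (τ 0), (1 : ZMod 2) = 0 := by
    refine Finset.sum_involution (fun s _ => τ s) ?_ ?_ ?_ ?_
    · intro s _; decide
    · intro s _ _; exact hτne s
    · intro s hs
      rw [Finset.mem_Ioo] at hs ⊢
      exact hmem s hs.1 hs.2
    · intro s hs
      rw [Finset.mem_Ioo] at hs
      exact hττ s (hs.2.trans (hτlt 0))
  rw [Finset.sum_const, nsmul_eq_mul, mul_one, ZMod.natCast_eq_zero_iff_even,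
    Nat.card_Ioo] at hsum
  obtain ⟨c, hc⟩ := hsum
  exact ⟨c, by omega⟩

theorem stmt3 (n : ℕ) (hn : 2 ≤ n) (v : ZMod (2 * n) → Pt) (hv : ConvexCyclic v)
    (F : Fin n → Set (Set Pt))
    (hpm : ∀ i, IsPerfectMatching (Set.range v) (F i))
    (hnc : ∀ i, NonCrossing (F i))
    (hdisj : ∀ i j, i ≠ j → Disjoint (F i) (F j)) :
    (⋃ i, F i) = Cedges n v := by
  have : NeZero (2 * n) := ⟨by omega⟩
  have hm : 3 ≤ 2 * n := by omega
  have hinj := v_inj hm v hv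
  choose σ h1 h2 h3 using fun i => pm_partner v hinj (F i) (hpm i)
  have hodd : ∀ i k, Odd (σ i k - k).val := fun i k =>
    odd_of_nc hm v hv (F i) (hnc i) (σ i) (h1 i) (h2 i) (h3 i) k
  choose q hq using hodd
  have hσ : ∀ i k, σ i k = k + (2 * (q i k : ZMod (2 * n)) + 1) := by
    intro i k
    have : ((σ i k - k).val : ZMod (2 * n)) = ((2 * q i k + 1 : ℕ) : ZMod (2 * n)) := by
      rw [hq]
    rw [ZMod.natCast_zmod_val] at this
    push_cast at this
    rw [← this]; ring
  have hql : ∀ i k, q i k < n := by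
    intro i k
    have := ZMod.val_lt (σ i k - k)
    rw [hq] at this
    omega
  ext e
  constructor
  · intro he
    obtain ⟨i, he⟩ := Set.mem_iUnion.1 he
    obtain ⟨a, b, hab, ⟨k, rfl⟩, ⟨l, rfl⟩, rfl⟩ := (hpm i).1 e he
    refine ⟨k, l, ⟨k + q i k, ?_⟩, rfl⟩
    rw [h3 i k l he, hσ]; ring
  · rintro ⟨k, l, ⟨t, ht⟩, rfl⟩
    have hf : Function.Injective (fun i : Fin n => (⟨q i k, hql i k⟩ : Fin n)) := by
      intro i j hij
      by_contra hne
      have hqq : q i k = q j k := by simpa using hij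
      have hs : σ i k = σ j k := by rw [hσ, hσ, hqq]
      have ha := h1 i k
      have hb := h1 j k
      rw [hs] at ha
      exact Set.disjoint_left.1 (hdisj i j hne) ha hb
    have hsurj := Finite.surjective_of_injective hf
    obtain ⟨i, hi⟩ := hsurj ⟨(t - k).val % n, Nat.mod_lt _ (by omega)⟩
    have hi' : q i k = (t - k).val % n := by simpa using hi
    refine Set.mem_iUnion.2 ⟨i, ?_⟩
    have hl : l = σ i k := by
      rw [hσ, hi']
      have e1 : (((t - k).val % n + n * ((t - k).val / n) : ℕ) : ZMod (2 * n)) = t - k := by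
        rw [Nat.mod_add_div, ZMod.natCast_zmod_val]
      have e2 : (2 : ZMod (2 * n)) * n = 0 := by
        have := ZMod.natCast_self (2 * n)
        push_cast at this; exact this
      rw [Nat.cast_add, Nat.cast_mul] at e1
      linear_combination ht - 2 * e1 + (((t - k).val / n : ℕ) : ZMod (2 * n)) * e2
    rw [hl]
    exact h1 i k
end
end

section
/- Let S be a set of 2n points in regular wheel configuration in the plane with n ≥ 8. Then for every k with k ≤ ⌈2n/3⌉ − 1 there exist k pairwise edge-disjoint non-crossing perfect matchings F_1, …, F_k on S, each having exactly 3 boundary edges, such that the union F_1 ∪ … ∪ F_k is a triangle-free geometric graph. -/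
noncomputable section

open Classical

/-- `2*n` points in regular wheel configuration: `x` is the center and
`u 0, u 1, …, u (2n−2)` are regularly spaced on a circle around `x`, in cyclic order. -/
def RegularWheel (n : ℕ) (x : Pt) (u : ZMod (2 * n - 1) → Pt) : Prop :=
  ∃ r θ : ℝ, 0 < r ∧ ∀ j : Fin (2 * n - 1),
    u ((j : ℕ) : ZMod (2 * n - 1)) =
      (x.1 + r * Real.cos (θ + 2 * Real.pi * (j : ℝ) / (2 * n - 1)),
       x.2 + r * Real.sin (θ + 2 * Real.pi * (j : ℝ) / (2 * n - 1)))


/-! ### Geometry -/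

theorem det2_affine (p q a b : Pt) (s t : ℝ) (h : s + t = 1) :
    det2 p q (s • a + t • b) = s * det2 p q a + t * det2 p q b := by
  obtain rfl : s = 1 - t := by linarith
  simp only [det2, Prod.fst_add, Prod.snd_add, Prod.smul_fst, Prod.smul_snd, smul_eq_mul]
  ring

theorem seg_disj (a b c d : Pt) (h : 0 < det2 a b c * det2 a b d) :
    openSeg {a, b} ∩ openSeg {c, d} = ∅ := by
  have key : ∀ y, y ∈ openSegment ℝ a b → y ∈ openSegment ℝ c d → False := by
    rintro y ⟨s, t, hs, ht, hst, rfl⟩ ⟨s', t', hs', ht', hst', he⟩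
    have h1 := det2_affine a b a b s t hst
    have h2 := det2_affine a b c d s' t' hst'
    rw [he, h1] at h2
    have h3 : det2 a b a = 0 := by simp [det2]
    have h4 : det2 a b b = 0 := by simp only [det2]; ring
    rw [h3, h4] at h2
    rcases pos_and_pos_or_neg_and_neg_of_mul_pos h with ⟨h5, h6⟩ | ⟨h5, h6⟩
    · nlinarith [mul_pos hs' h5, mul_pos ht' h6]
    · nlinarith [mul_pos hs' (neg_pos.2 h5), mul_pos ht' (neg_pos.2 h6)]
  have red : ∀ a b y : Pt, y ∈ openSeg {a, b} → y ∈ openSegment ℝ a b := by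
    rintro a b y ⟨p, hp, q, hq, hpq, hy⟩
    simp only [Set.mem_insert_iff, Set.mem_singleton_iff] at hp hq
    rcases hp with rfl | rfl <;> rcases hq with rfl | rfl
    · exact absurd rfl hpq
    · exact hy
    · rwa [openSegment_symm]
    · exact absurd rfl hpq
  rw [Set.eq_empty_iff_forall_notMem]
  rintro y ⟨h1, h2⟩
  exact key y (red _ _ _ h1) (red _ _ _ h2)

def cpt (x : Pt) (r θ : ℝ) (m : ℤ) (z : ℤ) : Pt :=
  (x.1 + r * Real.cos (θ + 2 * Real.pi * (z : ℝ) / m),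
   x.2 + r * Real.sin (θ + 2 * Real.pi * (z : ℝ) / m))

theorem trig_id (A B : ℝ) : Real.sin (2 * A) + Real.sin (2 * B) - Real.sin (2 * (A + B)) =
    4 * Real.sin A * Real.sin B * Real.sin (A + B) := by
  have h : 2 * (A + B) = 2 * A + 2 * B := by ring
  rw [h, Real.sin_add (2 * A), Real.sin_add A, Real.sin_two_mul, Real.sin_two_mul,
    Real.cos_two_mul, Real.cos_two_mul]
  linear_combination (-4 * Real.sin B * Real.cos B) * (Real.sin_sq_add_cos_sq A)
    + (-4 * Real.sin A * Real.cos A) * (Real.sin_sq_add_cos_sq B)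

theorem det_cpt (x : Pt) (r θ : ℝ) (m a b c : ℤ) :
    det2 (cpt x r θ m a) (cpt x r θ m b) (cpt x r θ m c) =
      4 * r ^ 2 * (Real.sin (Real.pi * ((b - a : ℤ) : ℝ) / m) *
        Real.sin (Real.pi * ((c - b : ℤ) : ℝ) / m) *
        Real.sin (Real.pi * ((c - a : ℤ) : ℝ) / m)) := by
  have h := trig_id (Real.pi * ((b - a : ℤ) : ℝ) / m) (Real.pi * ((c - b : ℤ) : ℝ) / m)
  have e1 : 2 * (Real.pi * ((b - a : ℤ) : ℝ) / m) =
    (θ + 2 * Real.pi * (b : ℝ) / m) - (θ + 2 * Real.pi * (a : ℝ) / m) := by push_cast; ring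
  have e2 : 2 * (Real.pi * ((c - b : ℤ) : ℝ) / m) =
    (θ + 2 * Real.pi * (c : ℝ) / m) - (θ + 2 * Real.pi * (b : ℝ) / m) := by push_cast; ring
  have e3 : 2 * (Real.pi * ((b - a : ℤ) : ℝ) / m + Real.pi * ((c - b : ℤ) : ℝ) / m) =
    (θ + 2 * Real.pi * (c : ℝ) / m) - (θ + 2 * Real.pi * (a : ℝ) / m) := by push_cast; ring
  have e4 : Real.pi * ((b - a : ℤ) : ℝ) / m + Real.pi * ((c - b : ℤ) : ℝ) / m =
    Real.pi * ((c - a : ℤ) : ℝ) / m := by push_cast; ring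
  rw [e3, e4, e1, e2] at h
  simp only [Real.sin_sub (θ + 2 * Real.pi * (_ : ℝ) / (m : ℝ))] at h
  simp only [det2, cpt]
  linear_combination r ^ 2 * h

theorem det_cpt_x (x : Pt) (r θ : ℝ) (m a b : ℤ) :
    det2 (cpt x r θ m a) (cpt x r θ m b) x =
      r ^ 2 * Real.sin (2 * (Real.pi * ((b - a : ℤ) : ℝ) / m)) := by
  have e1 : 2 * (Real.pi * ((b - a : ℤ) : ℝ) / m) =
    (θ + 2 * Real.pi * (b : ℝ) / m) - (θ + 2 * Real.pi * (a : ℝ) / m) := by push_cast; ring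
  rw [e1, Real.sin_sub]
  simp only [det2, cpt]
  ring

theorem sin_pos_int (m z : ℤ) (h0 : 0 < z) (h1 : z < m) :
    0 < Real.sin (Real.pi * (z : ℝ) / m) := by
  have hm : (0 : ℝ) < m := by exact_mod_cast h0.trans h1
  have hz : (0 : ℝ) < z := by exact_mod_cast h0
  have hzm : (z : ℝ) < m := by exact_mod_cast h1
  apply Real.sin_pos_of_pos_of_lt_pi
  · positivity
  · rw [div_lt_iff₀ hm]
    exact mul_lt_mul_of_pos_left hzm Real.pi_pos

theorem sin_neg_int (m z : ℤ) (h0 : z < 0) (h1 : -m < z) :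
    Real.sin (Real.pi * (z : ℝ) / m) < 0 := by
  have := sin_pos_int m (-z) (by omega) (by omega)
  rw [show Real.pi * ((-z : ℤ) : ℝ) / m = -(Real.pi * (z : ℝ) / m) by push_cast; ring,
    Real.sin_neg] at this
  linarith

theorem det_pos_out (x : Pt) (r θ : ℝ) (hr : 0 < r) (m a b c : ℤ) (hab : a < b) (hbm : b < a + m)
    (h : (c < a ∧ b < c + m) ∨ (b < c ∧ c < a + m)) :
    0 < det2 (cpt x r θ m a) (cpt x r θ m b) (cpt x r θ m c) := by
  rw [det_cpt]
  have h1 := sin_pos_int m (b - a) (by omega) (by omega)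
  rcases h with h | h
  · have h2 := sin_neg_int m (c - b) (by omega) (by omega)
    have h3 := sin_neg_int m (c - a) (by omega) (by omega)
    have := mul_pos_of_neg_of_neg h2 h3
    have := mul_pos h1 this
    rw [← mul_assoc] at this
    positivity
  · have h2 := sin_pos_int m (c - b) (by omega) (by omega)
    have h3 := sin_pos_int m (c - a) (by omega) (by omega)
    positivity

theorem chord_disj (x : Pt) (r θ : ℝ) (hr : 0 < r) (m a b c d : ℤ) (hab : a < b)
    (hbm : b < a + m)
    (hc : (c < a ∧ b < c + m) ∨ (b < c ∧ c < a + m))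
    (hd : (d < a ∧ b < d + m) ∨ (b < d ∧ d < a + m)) :
    openSeg {cpt x r θ m a, cpt x r θ m b} ∩ openSeg {cpt x r θ m c, cpt x r θ m d} = ∅ :=
  seg_disj _ _ _ _ (mul_pos (det_pos_out x r θ hr m a b c hab hbm hc)
    (det_pos_out x r θ hr m a b d hab hbm hd))

theorem spoke_disj (x : Pt) (r θ : ℝ) (hr : 0 < r) (m a b c : ℤ) (hab : a < b)
    (hbm : 2 * (b - a) < m)
    (hc : (c < a ∧ b < c + m) ∨ (b < c ∧ c < a + m)) :
    openSeg {cpt x r θ m a, cpt x r θ m b} ∩ openSeg {x, cpt x r θ m c} = ∅ := by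
  refine seg_disj _ _ _ _ (mul_pos ?_ (det_pos_out x r θ hr m a b c hab (by omega) hc))
  rw [det_cpt_x]
  have h := sin_pos_int m (2 * (b - a)) (by omega) hbm
  rw [show 2 * (Real.pi * ((b - a : ℤ) : ℝ) / m) = Real.pi * ((2 * (b - a) : ℤ) : ℝ) / m by
    push_cast; ring]
  positivity

theorem cpt_inj (x : Pt) (r θ : ℝ) (hr : 0 < r) (m y z : ℤ) (hm : 0 < m)
    (h : cpt x r θ m y = cpt x r θ m z) : m ∣ y - z := by
  have hm' : (m : ℝ) ≠ 0 := by exact_mod_cast hm.ne'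
  simp only [cpt, Prod.mk.injEq, add_right_inj, mul_eq_mul_left_iff, hr.ne', or_false] at h
  have h1 : Real.cos ((θ + 2 * Real.pi * (y : ℝ) / m) - (θ + 2 * Real.pi * (z : ℝ) / m)) = 1 := by
    rw [Real.cos_sub, h.1, h.2]
    linear_combination Real.sin_sq_add_cos_sq (θ + 2 * Real.pi * (z : ℝ) / m)
  obtain ⟨k, hk⟩ := (Real.cos_eq_one_iff _).1 h1
  refine ⟨k, ?_⟩
  have hpi := Real.pi_ne_zero
  have : ((y - z : ℤ) : ℝ) = ((m * k : ℤ) : ℝ) := by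
    push_cast
    field_simp at hk
    have h2 : 2 * Real.pi * ((y : ℝ) - z) = 2 * Real.pi * (m * k) := by linarith
    exact mul_left_cancel₀ (by positivity) h2
  exact_mod_cast this

theorem cpt_ne (x : Pt) (r θ : ℝ) (hr : 0 < r) (m z : ℤ) : cpt x r θ m z ≠ x := by
  intro h
  have h1 := congrArg Prod.fst h
  have h2 := congrArg Prod.snd h
  simp only [cpt, add_eq_left, mul_eq_zero, hr.ne', false_or] at h1 h2
  have := Real.sin_sq_add_cos_sq (θ + 2 * Real.pi * (z : ℝ) / m)
  rw [h1, h2] at this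
  norm_num at this

theorem cpt_periodic (x : Pt) (r θ : ℝ) (m z k : ℤ) (hm : 0 < m) :
    cpt x r θ m (z + m * k) = cpt x r θ m z := by
  have hm' : (m : ℝ) ≠ 0 := by exact_mod_cast hm.ne'
  have : θ + 2 * Real.pi * ((z + m * k : ℤ) : ℝ) / m =
      θ + 2 * Real.pi * (z : ℝ) / m + k * (2 * Real.pi) := by
    push_cast; field_simp; ring
  simp only [cpt, this, Real.cos_add_int_mul_two_pi, Real.sin_add_int_mul_two_pi]

theorem wheel_eq (n : ℕ) (hn : 8 ≤ n) (x : Pt) (u : ZMod (2 * n - 1) → Pt) (r θ : ℝ)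
    (h : ∀ j : Fin (2 * n - 1),
    u ((j : ℕ) : ZMod (2 * n - 1)) =
      (x.1 + r * Real.cos (θ + 2 * Real.pi * (j : ℝ) / (2 * n - 1)),
       x.2 + r * Real.sin (θ + 2 * Real.pi * (j : ℝ) / (2 * n - 1)))) (z : ℤ) :
    u (z : ZMod (2 * n - 1)) = cpt x r θ (2 * n - 1) z := by
  have hm : (0 : ℤ) < 2 * n - 1 := by omega
  have h0 := Int.emod_nonneg z hm.ne'
  have h1 := Int.emod_lt_of_pos z hm
  obtain ⟨j, hj⟩ := Int.eq_ofNat_of_zero_le h0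
  have hjm : j < 2 * n - 1 := by omega
  have hz : z = (j : ℤ) + (2 * n - 1 : ℤ) * (z / (2 * n - 1)) := by
    have := Int.emod_add_mul_ediv z (2 * n - 1)
    rw [hj] at this; exact this.symm
  have h2 := h ⟨j, hjm⟩
  rw [hz, cpt_periodic _ _ _ _ _ _ hm]
  have h3 : (((j : ℤ) + (2 * n - 1 : ℤ) * (z / (2 * n - 1)) : ℤ) : ZMod (2 * n - 1))
      = (j : ZMod (2 * n - 1)) := by
    have e : (2 * n - 1 : ℤ) = ((2 * n - 1 : ℕ) : ℤ) := by omega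
    rw [e]
    generalize 2 * n - 1 = M
    push_cast
    simp
  rw [h3]
  simp only at h2
  rw [h2, cpt]
  push_cast
  rfl

/-! ### Combinatorics -/

def RR (p q r a b : ℤ) : Prop :=
  (1 ≤ a ∧ a ≤ 2 * p ∧ a + b = 2 * p + 1) ∨
  (2 * p < a ∧ a ≤ 2 * p + 2 * q ∧ a + b = 4 * p + 2 * q + 1) ∨
  (2 * p + 2 * q < a ∧ a ≤ 2 * p + 2 * q + 2 * r ∧ a + b = 4 * p + 4 * q + 2 * r + 1)

/-- parameters -/
def Good (m k p q r t : ℤ) : Prop :=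
  2 ≤ t ∧
  ((m = 6 * t + 1 ∧ k ≤ 2 * t ∧ p = t + 1 ∧ q = t ∧ r = t - 1) ∨
   (m = 6 * t + 3 ∧ k ≤ 2 * t + 1 ∧ p = t ∧ q = t + 1 ∧ r = t) ∨
   (m = 6 * t + 5 ∧ k ≤ 2 * t + 1 ∧ p = t + 1 ∧ q = t ∧ r = t + 1))

def MM (x : Pt) (P : ℤ → Pt) (p q r : ℤ) (s : ℤ) : Set (Set Pt) :=
  {e | e = {x, P s} ∨ ∃ a b : ℤ, RR p q r a b ∧ e = {P (s + a), P (s + b)}}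

theorem RR_symm {p q r a b : ℤ} (h : RR p q r a b) : RR p q r b a := by
  unfold RR at *; omega

theorem dvd_congr {m a b : ℤ} (h : m ∣ a) (e : b = a) : m ∣ b := e ▸ h

theorem RR_fun {p q r a b c : ℤ} (hp : 1 ≤ p) (hq : 1 ≤ q) (hr : 1 ≤ r) (h : RR p q r a b) (h' : RR p q r a c) : b = c := by
  unfold RR at *; omega

theorem RR_range {p q r a b : ℤ} (hp : 0 ≤ p) (hq : 0 ≤ q) (hr : 0 ≤ r) (h : RR p q r a b) :
    1 ≤ a ∧ a ≤ 2 * p + 2 * q + 2 * r := by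
  unfold RR at *; omega

theorem small_mult {m d k : ℤ} (h1 : -m < d) (h2 : d < m) (h : d = m * k) : d = 0 :=
  Int.eq_zero_of_abs_lt_dvd ⟨k, h⟩ (abs_lt.2 ⟨h1, h2⟩)

theorem mult_cases {m d : ℤ} (hm : 0 < m) (h1 : -(2 * m) < d) (h2 : d < 2 * m) (h : m ∣ d) :
    d = 0 ∨ d = m ∨ d = -m := by
  obtain ⟨k, rfl⟩ := h
  have h3 : k < 2 := by nlinarith
  have h4 : -2 < k := by nlinarith
  have : k = -1 ∨ k = 0 ∨ k = 1 := by omega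
  rcases this with rfl | rfl | rfl <;> simp

section comb
variable {x : Pt} {P : ℤ → Pt} {m k p q r t : ℤ}

theorem mem_chord (hP : ∀ y z, P y = P z ↔ m ∣ y - z) (hx : ∀ z, P z ≠ x) (s y z : ℤ) :
    ({P y, P z} : Set Pt) ∈ MM x P p q r s ↔
      ∃ a b, RR p q r a b ∧ m ∣ y - (s + a) ∧ m ∣ z - (s + b) := by
  constructor
  · rintro (h | ⟨a, b, hab, h⟩)
    · rw [Set.pair_eq_pair_iff] at h
      rcases h with h | h
      · exact absurd h.1 (hx _)
      · exact absurd h.2 (hx _)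
    · rw [Set.pair_eq_pair_iff] at h
      rcases h with h | h
      · exact ⟨a, b, hab, (hP _ _).1 h.1, (hP _ _).1 h.2⟩
      · exact ⟨b, a, RR_symm hab, (hP _ _).1 h.1, (hP _ _).1 h.2⟩
  · rintro ⟨a, b, hab, h1, h2⟩
    refine Or.inr ⟨a, b, hab, ?_⟩
    rw [(hP _ _).2 h1, (hP _ _).2 h2]

theorem mem_spoke (hP : ∀ y z, P y = P z ↔ m ∣ y - z) (hx : ∀ z, P z ≠ x) (s z : ℤ) :
    ({x, P z} : Set Pt) ∈ MM x P p q r s ↔ m ∣ z - s := by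
  constructor
  · rintro (h | ⟨a, b, hab, h⟩)
    · rw [Set.pair_eq_pair_iff] at h
      rcases h with h | h
      · exact (hP _ _).1 h.2
      · exact absurd h.2 (hx _)
    · rw [Set.pair_eq_pair_iff] at h
      rcases h with h | h
      · exact absurd h.1.symm (hx _)
      · exact absurd h.1.symm (hx _)
  · intro h
    left
    rw [(hP _ _).2 h]

theorem good_pos (hg : Good m k p q r t) :
    1 ≤ p ∧ 1 ≤ q ∧ 1 ≤ r ∧ m = 2 * p + 2 * q + 2 * r + 1 := by
  unfold Good at hg; omega

theorem MM_perfect (hP : ∀ y z, P y = P z ↔ m ∣ y - z) (hx : ∀ z, P z ≠ x)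
    (hg : Good m k p q r t) (s : ℤ) :
    IsPerfectMatching (insert x (Set.range P)) (MM x P p q r s) := by
  obtain ⟨hp, hq, hr, hm⟩ := good_pos hg
  constructor
  · rintro e (rfl | ⟨a, b, hab, rfl⟩)
    · exact ⟨x, P s, (hx s).symm, by simp, by simp, rfl⟩
    · refine ⟨_, _, ?_, by simp, by simp, rfl⟩
      rw [Ne, hP]
      rintro ⟨j, hj⟩
      have h1 := RR_range (by omega) (by omega) (by omega) hab
      have h2 := RR_range (by omega) (by omega) (by omega) (RR_symm hab)
      have := small_mult (by omega) (by omega) hj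
      unfold RR at hab; omega
  · rintro y (rfl | ⟨z, rfl⟩)
    · refine ⟨{y, P s}, ⟨Or.inl rfl, by simp⟩, ?_⟩
      rintro e ⟨rfl | ⟨a, b, hab, rfl⟩, he⟩
      · rfl
      · simp only [Set.mem_insert_iff, Set.mem_singleton_iff] at he
        rcases he with he | he
        · exact absurd he.symm (hx _)
        · exact absurd he.symm (hx _)
    · have hm0 : 0 < m := by omega
      obtain ⟨w, hw0, hwm, hzw⟩ : ∃ w, 0 ≤ w ∧ w < m ∧ P z = P (s + w) := by
        refine ⟨(z - s) % m, Int.emod_nonneg _ hm0.ne', Int.emod_lt_of_pos _ hm0, ?_⟩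
        rw [hP]
        have := Int.dvd_self_sub_emod (x := z - s) (m := m)
        exact dvd_congr this (by ring)
      rw [hzw]
      by_cases hw : w = 0
      · subst hw
        refine ⟨{x, P s}, ⟨Or.inl rfl, by simp⟩, ?_⟩
        rintro e ⟨rfl | ⟨a, b, hab, rfl⟩, he⟩
        · rfl
        · exfalso
          have h1 := RR_range (by omega) (by omega) (by omega) hab
          have h2 := RR_range (by omega) (by omega) (by omega) (RR_symm hab)
          simp only [Set.mem_insert_iff, Set.mem_singleton_iff] at he
          rcases he with he | he
          · obtain ⟨j, hj⟩ := (hP _ _).1 he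
            have := small_mult (by omega) (by omega) hj
            omega
          · obtain ⟨j, hj⟩ := (hP _ _).1 he
            have := small_mult (by omega) (by omega) hj
            omega
      · obtain ⟨v, hv⟩ : ∃ v, RR p q r w v := by
          unfold RR
          by_cases c1 : w ≤ 2 * p
          · exact ⟨2 * p + 1 - w, by omega⟩
          by_cases c2 : w ≤ 2 * p + 2 * q
          · exact ⟨4 * p + 2 * q + 1 - w, by omega⟩
          · exact ⟨4 * p + 4 * q + 2 * r + 1 - w, by omega⟩
        refine ⟨{P (s + w), P (s + v)}, ⟨Or.inr ⟨w, v, hv, rfl⟩, by simp⟩, ?_⟩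
        rintro e ⟨rfl | ⟨a, b, hab, rfl⟩, he⟩
        · exfalso
          simp only [Set.mem_insert_iff, Set.mem_singleton_iff] at he
          rcases he with he | he
          · exact hx _ he
          · obtain ⟨j, hj⟩ := (hP _ _).1 he
            have := small_mult (by omega) (by omega) hj
            omega
        · have h1 := RR_range (by omega) (by omega) (by omega) hab
          have h2 := RR_range (by omega) (by omega) (by omega) (RR_symm hab)
          simp only [Set.mem_insert_iff, Set.mem_singleton_iff] at he
          rcases he with he | he
          · obtain ⟨j, hj⟩ := (hP _ _).1 he
            have := small_mult (by omega) (by omega) hj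
            obtain rfl : w = a := by omega
            rw [RR_fun hp hq hr hv hab]
          · obtain ⟨j, hj⟩ := (hP _ _).1 he
            have := small_mult (by omega) (by omega) hj
            obtain rfl : w = b := by omega
            rw [RR_fun hp hq hr hv (RR_symm hab), Set.pair_comm]

theorem MM_disj (hP : ∀ y z, P y = P z ↔ m ∣ y - z) (hx : ∀ z, P z ≠ x)
    (hg : Good m k p q r t) (i j : ℤ) (hi : 0 ≤ i) (hik : i < k) (hj : 0 ≤ j) (hjk : j < k)
    (hij : i ≠ j) : Disjoint (MM x P p q r (2 * i)) (MM x P p q r (2 * j)) := by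
  obtain ⟨hp, hq, hr, hm⟩ := good_pos hg
  rw [Set.disjoint_left]
  rintro e (rfl | ⟨a, b, hab, rfl⟩) he
  · rw [mem_spoke hP hx] at he
    have := mult_cases (by omega) (by unfold Good at hg; omega) (by unfold Good at hg; omega) he
    omega
  · rw [mem_chord hP hx] at he
    obtain ⟨c, d, hcd, h1, h2⟩ := he
    have a1 := RR_range (by omega) (by omega) (by omega) hab
    have a2 := RR_range (by omega) (by omega) (by omega) (RR_symm hab)
    have a3 := RR_range (by omega) (by omega) (by omega) hcd
    have a4 := RR_range (by omega) (by omega) (by omega) (RR_symm hcd)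
    have b1 := mult_cases (by omega) (by unfold Good at hg; omega) (by unfold Good at hg; omega) h1
    have b2 := mult_cases (by omega) (by unfold Good at hg; omega) (by unfold Good at hg; omega) h2
    unfold RR at hab hcd
    unfold Good at hg
    obtain ⟨ht, hg⟩ := hg
    rcases hg with ⟨rfl, hg, rfl, rfl, rfl⟩ | ⟨rfl, hg, rfl, rfl, rfl⟩ | ⟨rfl, hg, rfl, rfl, rfl⟩ <;>
    rcases b1 with b1 | b1 | b1 <;> rcases b2 with b2 | b2 | b2 <;>
    rcases hab with hab | hab | hab <;> rcases hcd with hcd | hcd | hcd <;> omega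

theorem spoke_tri (hP : ∀ y z, P y = P z ↔ m ∣ y - z) (hx : ∀ z, P z ≠ x)
    (hg : Good m k p q r t) (i j l y z : ℤ) (hi : 0 ≤ i) (hik : i < k) (hj : 0 ≤ j) (hjk : j < k)
    (h1 : ({x, P y} : Set Pt) ∈ MM x P p q r (2 * i))
    (h2 : ({x, P z} : Set Pt) ∈ MM x P p q r (2 * j))
    (h3 : ({P y, P z} : Set Pt) ∈ MM x P p q r (2 * l)) : False := by
  rw [mem_spoke hP hx] at h1 h2
  rw [mem_chord hP hx] at h3
  obtain ⟨a, b, hab, h3, h4⟩ := h3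
  have h5 : m ∣ (2 * i - 2 * j) - (a - b) := by
    have := dvd_add (dvd_sub h3 h1) (dvd_sub h2 h4)
    exact dvd_congr this (by ring)
  unfold RR at hab
  unfold Good at hg
  have := mult_cases (by omega) (by omega) (by omega) h5
  obtain ⟨ht, hg⟩ := hg
  rcases hg with hg | hg | hg <;> rcases this with b1 | b1 | b1 <;>
    rcases hab with hab | hab | hab <;> omega

theorem chord_len (hP : ∀ y z, P y = P z ↔ m ∣ y - z) (hx : ∀ z, P z ≠ x)
    (hg : Good m k p q r t) (i y z : ℤ)
    (h : ({P y, P z} : Set Pt) ∈ MM x P p q r (2 * i)) :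
    ∃ d, m ∣ (z - y) - d ∧ d % 2 = 1 ∧ d ≤ 2 * t + 1 ∧ - (2 * t + 1) ≤ d ∧
      (d = 2 * t + 1 → m = 6 * t + 5 ∨ (m = 6 * t + 1 ∧ m ∣ y - (2 * i + 1)) ∨
        (m = 6 * t + 3 ∧ m ∣ y - (2 * i + (2 * t + 1)))) ∧
      (d = -(2 * t + 1) → m = 6 * t + 5 ∨ (m = 6 * t + 1 ∧ m ∣ z - (2 * i + 1)) ∨
        (m = 6 * t + 3 ∧ m ∣ z - (2 * i + (2 * t + 1)))) := by
  rw [mem_chord hP hx] at h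
  obtain ⟨a, b, hab, h1, h2⟩ := h
  refine ⟨b - a, ?_, ?_, ?_, ?_, ?_, ?_⟩
  · have := dvd_sub h2 h1
    exact dvd_congr this (by ring)
  · unfold RR at hab; omega
  · unfold RR at hab; unfold Good at hg; omega
  · unfold RR at hab; unfold Good at hg; omega
  · intro hd
    have : m = 6 * t + 5 ∨ (m = 6 * t + 1 ∧ a = 1) ∨ (m = 6 * t + 3 ∧ a = 2 * t + 1) := by
      unfold RR at hab; unfold Good at hg; omega
    rcases this with h | ⟨h, rfl⟩ | ⟨h, rfl⟩
    · exact Or.inl h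
    · exact Or.inr (Or.inl ⟨h, h1⟩)
    · exact Or.inr (Or.inr ⟨h, h1⟩)
  · intro hd
    have : m = 6 * t + 5 ∨ (m = 6 * t + 1 ∧ b = 1) ∨ (m = 6 * t + 3 ∧ b = 2 * t + 1) := by
      unfold RR at hab; unfold Good at hg; omega
    rcases this with h | ⟨h, rfl⟩ | ⟨h, rfl⟩
    · exact Or.inl h
    · exact Or.inr (Or.inl ⟨h, h2⟩)
    · exact Or.inr (Or.inr ⟨h, h2⟩)

/-- two consecutive starting points of longest edges cannot differ by `2t+1`. -/
theorem long_two (hg : Good m k p q r t) (i j y z w : ℤ) (hi : 0 ≤ i) (hik : i < k)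
    (hj : 0 ≤ j) (hjk : j < k) (h : m ≠ 6 * t + 5)
    (h1 : m ∣ y - (2 * i + w)) (h2 : m ∣ z - (2 * j + w))
    (h3 : m ∣ (z - y) - (2 * t + 1)) : False := by
  have h5 : m ∣ (2 * j - 2 * i) - (2 * t + 1) := by
    have := dvd_add (dvd_sub h1 h2) h3
    exact dvd_congr this (by ring)
  unfold Good at hg
  have := mult_cases (by omega) (by omega) (by omega) h5
  omega

theorem chord_tri_pos (hg : Good m k p q r t) (i j l y z w d1 d2 d3 : ℤ)
    (hi : 0 ≤ i) (hik : i < k) (hj : 0 ≤ j) (hjk : j < k) (hl : 0 ≤ l) (hlk : l < k)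
    (m1 : m ∣ (z - y) - d1) (m2 : m ∣ (w - z) - d2) (m3 : m ∣ (y - w) - d3)
    (o1 : d1 % 2 = 1) (o2 : d2 % 2 = 1) (o3 : d3 % 2 = 1)
    (u1 : d1 ≤ 2 * t + 1) (u2 : d2 ≤ 2 * t + 1) (u3 : d3 ≤ 2 * t + 1)
    (hs : d1 + d2 + d3 = m)
    (e1 : d1 = 2 * t + 1 → m = 6 * t + 5 ∨ (m = 6 * t + 1 ∧ m ∣ y - (2 * i + 1)) ∨
        (m = 6 * t + 3 ∧ m ∣ y - (2 * i + (2 * t + 1))))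
    (e2 : d2 = 2 * t + 1 → m = 6 * t + 5 ∨ (m = 6 * t + 1 ∧ m ∣ z - (2 * j + 1)) ∨
        (m = 6 * t + 3 ∧ m ∣ z - (2 * j + (2 * t + 1))))
    (e3 : d3 = 2 * t + 1 → m = 6 * t + 5 ∨ (m = 6 * t + 1 ∧ m ∣ w - (2 * l + 1)) ∨
        (m = 6 * t + 3 ∧ m ∣ w - (2 * l + (2 * t + 1)))) : False := by
  have key : ∀ (i j y z d1 d2 : ℤ), 0 ≤ i → i < k → 0 ≤ j → j < k → m ∣ (z - y) - d1 →
    d1 = 2 * t + 1 → d2 = 2 * t + 1 → (d1 = 2 * t + 1 → m = 6 * t + 5 ∨ (m = 6 * t + 1 ∧ m ∣ y - (2 * i + 1)) ∨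
        (m = 6 * t + 3 ∧ m ∣ y - (2 * i + (2 * t + 1)))) →
    (d2 = 2 * t + 1 → m = 6 * t + 5 ∨ (m = 6 * t + 1 ∧ m ∣ z - (2 * j + 1)) ∨
        (m = 6 * t + 3 ∧ m ∣ z - (2 * j + (2 * t + 1)))) → m ≠ 6 * t + 5 → False := by
    intro i j y z d1 d2 hi hik hj hjk hd h1 h2 e1 e2 hm
    subst h1
    rcases e1 rfl with e | e | e
    · exact hm e
    · rcases e2 h2 with f | f | f
      · exact hm f
      · exact long_two hg i j y z 1 hi hik hj hjk hm e.2 f.2 hd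
      · omega
    · rcases e2 h2 with f | f | f
      · exact hm f
      · omega
      · exact long_two hg i j y z _ hi hik hj hjk hm e.2 f.2 hd
  have hm : m ≠ 6 * t + 5 := by omega
  have hm2 : m = 6 * t + 1 ∨ m = 6 * t + 3 := by unfold Good at hg; omega
  have : (d1 = 2 * t + 1 ∧ d2 = 2 * t + 1) ∨ (d2 = 2 * t + 1 ∧ d3 = 2 * t + 1) ∨
      (d3 = 2 * t + 1 ∧ d1 = 2 * t + 1) := by omega
  rcases this with h | h | h
  · exact key i j y z d1 d2 hi hik hj hjk m1 h.1 h.2 e1 e2 hm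
  · exact key j l z w d2 d3 hj hjk hl hlk m2 h.1 h.2 e2 e3 hm
  · exact key l i w y d3 d1 hl hlk hi hik m3 h.1 h.2 e3 e1 hm

theorem chord_tri (hP : ∀ y z, P y = P z ↔ m ∣ y - z) (hx : ∀ z, P z ≠ x)
    (hg : Good m k p q r t) (i j l y z w : ℤ)
    (hi : 0 ≤ i) (hik : i < k) (hj : 0 ≤ j) (hjk : j < k) (hl : 0 ≤ l) (hlk : l < k)
    (h1 : ({P y, P z} : Set Pt) ∈ MM x P p q r (2 * i))
    (h2 : ({P z, P w} : Set Pt) ∈ MM x P p q r (2 * j))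
    (h3 : ({P w, P y} : Set Pt) ∈ MM x P p q r (2 * l)) : False := by
  obtain ⟨d1, m1, o1, u1, l1, e1, f1⟩ := chord_len hP hx hg i y z h1
  obtain ⟨d2, m2, o2, u2, l2, e2, f2⟩ := chord_len hP hx hg j z w h2
  obtain ⟨d3, m3, o3, u3, l3, e3, f3⟩ := chord_len hP hx hg l w y h3
  have hd : m ∣ d1 + d2 + d3 := by
    have := dvd_neg.2 (dvd_add (dvd_add m1 m2) m3)
    exact dvd_congr this (by ring)
  have hm : 6 * t + 1 ≤ m ∧ 2 ≤ t := by unfold Good at hg; omega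
  rcases mult_cases (by omega) (by omega) (by omega) hd with h | h | h
  · omega
  · exact chord_tri_pos hg i j l y z w d1 d2 d3 hi hik hj hjk hl hlk m1 m2 m3 o1 o2 o3 u1 u2 u3 h
      e1 e2 e3
  · have neg : ∀ a b d : ℤ, m ∣ (a - b) - d → m ∣ (b - a) - (-d) := by
      intro a b d h
      have := dvd_neg.2 h
      exact dvd_congr this (by ring)
    exact chord_tri_pos hg l j i y w z (-d3) (-d2) (-d1) hl hlk hj hjk hi hik
      (neg _ _ _ m3) (neg _ _ _ m2) (neg _ _ _ m1)
      (by omega) (by omega) (by omega) (by omega) (by omega) (by omega) (by omega)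
      (fun h => f3 (by omega)) (fun h => f2 (by omega)) (fun h => f1 (by omega))

theorem MM_tri (hP : ∀ y z, P y = P z ↔ m ∣ y - z) (hx : ∀ z, P z ≠ x)
    (hg : Good m k p q r t) (E : Set (Set Pt))
    (hE : ∀ e ∈ E, ∃ i : ℤ, 0 ≤ i ∧ i < k ∧ e ∈ MM x P p q r (2 * i)) : TriangleFree E := by
  have pts : ∀ a b : Pt, ({a, b} : Set Pt) ∈ E → a = x ∨ ∃ z, a = P z := by
    intro a b h
    obtain ⟨i, -, -, h | ⟨c, d, -, h⟩⟩ := hE _ h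
    · have : a ∈ ({x, P (2 * i)} : Set Pt) := h ▸ (by simp)
      rcases this with h | h
      · exact Or.inl h
      · exact Or.inr ⟨_, h⟩
    · have : a ∈ ({P (2 * i + c), P (2 * i + d)} : Set Pt) := h ▸ (by simp)
      rcases this with h | h
      · exact Or.inr ⟨_, h⟩
      · exact Or.inr ⟨_, h⟩
  have spk : ∀ y z, ({x, P y} : Set Pt) ∈ E → ({x, P z} : Set Pt) ∈ E →
      ({P y, P z} : Set Pt) ∈ E → False := by
    intro y z h1 h2 h3
    obtain ⟨i, hi, hik, h1⟩ := hE _ h1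
    obtain ⟨j, hj, hjk, h2⟩ := hE _ h2
    obtain ⟨l, hl, hlk, h3⟩ := hE _ h3
    exact spoke_tri hP hx hg i j l y z hi hik hj hjk h1 h2 h3
  rintro ⟨a, b, c, hab, hac, hbc, h1, h2, h3⟩
  have h1' : ({b, a} : Set Pt) ∈ E := by rwa [Set.pair_comm]
  have h2' : ({c, b} : Set Pt) ∈ E := by rwa [Set.pair_comm]
  have h3' : ({c, a} : Set Pt) ∈ E := by rwa [Set.pair_comm]
  rcases pts _ _ h1 with ha | ⟨y, rfl⟩
  · subst ha
    rcases pts _ _ h2 with rfl | ⟨z, rfl⟩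
    · exact hab rfl
    rcases pts _ _ h3' with rfl | ⟨w, rfl⟩
    · exact hac rfl
    exact spk z w h1 h3 h2
  · rcases pts _ _ h2 with hb | ⟨z, rfl⟩
    · subst hb
      rcases pts _ _ h3' with rfl | ⟨w, rfl⟩
      · exact hbc rfl
      exact spk y w h1' h2 h3
    · rcases pts _ _ h3' with hc | ⟨w, rfl⟩
      · subst hc
        exact spk y z h3' h2' h1
      · obtain ⟨i, hi, hik, h1⟩ := hE _ h1
        obtain ⟨j, hj, hjk, h2⟩ := hE _ h2
        obtain ⟨l, hl, hlk, h3⟩ := hE _ h3'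
        exact chord_tri hP hx hg i j l y z w hi hik hj hjk hl hlk h1 h2 h3

theorem MM_bdry (hP : ∀ y z, P y = P z ↔ m ∣ y - z) (hx : ∀ z, P z ≠ x)
    (hg : Good m k p q r t) (s z : ℤ) :
    ({P z, P (z + 1)} : Set Pt) ∈ MM x P p q r s ↔
      m ∣ z - (s + p) ∨ m ∣ z - (s + (2 * p + q)) ∨ m ∣ z - (s + (2 * p + 2 * q + r)) := by
  obtain ⟨hp, hq, hr, hm⟩ := good_pos hg
  rw [mem_chord hP hx]
  constructor
  · rintro ⟨a, b, hab, h1, h2⟩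
    have h3 : m ∣ b - a - 1 := by
      have := dvd_sub h1 h2
      exact dvd_congr this (by ring)
    have a1 := RR_range (by omega) (by omega) (by omega) hab
    have a2 := RR_range (by omega) (by omega) (by omega) (RR_symm hab)
    have h4 := mult_cases (by omega) (by omega) (by omega) h3
    have : a = p ∨ a = 2 * p + q ∨ a = 2 * p + 2 * q + r := by
      unfold Good at hg
      unfold RR at hab
      omega
    rcases this with rfl | rfl | rfl
    · exact Or.inl h1
    · exact Or.inr (Or.inl h1)
    · exact Or.inr (Or.inr h1)
  · have sh : ∀ a, m ∣ z - (s + a) → m ∣ z + 1 - (s + (a + 1)) := by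
      intro a h
      exact dvd_congr h (by ring)
    rintro (h | h | h)
    · exact ⟨p, p + 1, by unfold RR; omega, h, sh _ h⟩
    · exact ⟨_, _, by unfold RR; omega, h, sh _ h⟩
    · exact ⟨_, _, by unfold RR; omega, h, sh _ h⟩

end comb

theorem MM_noncross (x : Pt) (ρ θ : ℝ) (hρ : 0 < ρ) {m k p q r t : ℤ}
    (hg : Good m k p q r t) (s : ℤ) :
    NonCrossing (MM x (cpt x ρ θ m) p q r s) := by
  obtain ⟨hp, hq, hr, hm⟩ := good_pos hg
  have norm : ∀ e : Set Pt, (∃ a b : ℤ, RR p q r a b ∧ e = {cpt x ρ θ m (s + a), cpt x ρ θ m (s + b)}) →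
      ∃ a b : ℤ, a < b ∧ RR p q r a b ∧ e = {cpt x ρ θ m (s + a), cpt x ρ θ m (s + b)} := by
    rintro e ⟨a, b, hab, rfl⟩
    rcases lt_trichotomy a b with h | h | h
    · exact ⟨a, b, h, hab, rfl⟩
    · unfold RR at hab; omega
    · exact ⟨b, a, h, RR_symm hab, Set.pair_comm _ _⟩
  have sp : ∀ a b : ℤ, a < b → RR p q r a b →
      openSeg {cpt x ρ θ m (s + a), cpt x ρ θ m (s + b)} ∩ openSeg {x, cpt x ρ θ m s} = ∅ := by
    intro a b h hab
    have a1 := RR_range (by omega) (by omega) (by omega) hab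
    have a2 := RR_range (by omega) (by omega) (by omega) (RR_symm hab)
    apply spoke_disj x ρ θ hρ
    · omega
    · unfold RR at hab; unfold Good at hg; omega
    · omega
  rintro e (rfl | he) f (rfl | hf) hne
  · exact absurd rfl hne
  · obtain ⟨a, b, h, hab, rfl⟩ := norm f hf
    rw [Set.inter_comm]
    exact sp a b h hab
  · obtain ⟨a, b, h, hab, rfl⟩ := norm e he
    exact sp a b h hab
  · obtain ⟨a, b, h, hab, rfl⟩ := norm e he
    obtain ⟨c, d, h', hcd, rfl⟩ := norm f hf
    have hac : a ≠ c := by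
      rintro rfl
      exact hne (by rw [RR_fun hp hq hr hab hcd])
    have a1 := RR_range (by omega) (by omega) (by omega) hab
    have a2 := RR_range (by omega) (by omega) (by omega) (RR_symm hab)
    have a3 := RR_range (by omega) (by omega) (by omega) hcd
    have a4 := RR_range (by omega) (by omega) (by omega) (RR_symm hcd)
    have : (b < c ∨ d < a) ∨ (c < a ∧ b < d) ∨ (a < c ∧ d < b) := by
      unfold RR at hab hcd; omega
    rcases this with g | g | g
    · exact chord_disj x ρ θ hρ m _ _ _ _ (by omega) (by omega) (by omega) (by omega)
    · exact chord_disj x ρ θ hρ m _ _ _ _ (by omega) (by omega) (by omega) (by omega)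
    · rw [Set.inter_comm]
      exact chord_disj x ρ θ hρ m _ _ _ _ (by omega) (by omega) (by omega) (by omega)

theorem good_exists (n k : ℕ) (hn : 8 ≤ n) (hk : k ≤ (2 * n + 2) / 3 - 1) :
    ∃ p q r t : ℤ, Good (2 * n - 1) k p q r t := by
  unfold Good
  have : n % 3 = 0 ∨ n % 3 = 1 ∨ n % 3 = 2 := by omega
  rcases this with h | h | h
  · exact ⟨_, _, _, ((n / 3 : ℕ) : ℤ) - 1, by omega, Or.inr (Or.inr ⟨by omega, by omega, rfl, rfl, rfl⟩)⟩
  · exact ⟨_, _, _, ((n / 3 : ℕ) : ℤ), by omega, Or.inl ⟨by omega, by omega, rfl, rfl, rfl⟩⟩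
  · exact ⟨_, _, _, ((n / 3 : ℕ) : ℤ), by omega, Or.inr (Or.inl ⟨by omega, by omega, rfl, rfl, rfl⟩)⟩

/-- Let `S` be `2n` points in regular wheel configuration, `n ≥ 8`.
For every `k ≤ ⌈2n/3⌉ − 1` there exist `k` pairwise edge-disjoint non-crossing perfect
matchings on `S`, each having exactly `3` boundary edges, whose union is a triangle-free
geometric graph. (In ℕ, `⌈2n/3⌉ = (2n+2)/3`.) -/
theorem stmt8 (n : ℕ) (hn : 8 ≤ n) (x : Pt) (u : ZMod (2 * n - 1) → Pt)
    (hw : RegularWheel n x u) (k : ℕ) (hk : k ≤ (2 * n + 2) / 3 - 1) :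
    ∃ F : Fin k → Set (Set Pt),
      (∀ i, IsPerfectMatching (insert x (Set.range u)) (F i)) ∧
      (∀ i, NonCrossing (F i)) ∧
      (∀ i j, i ≠ j → Disjoint (F i) (F j)) ∧
      (∀ i, {j : ZMod (2 * n - 1) | ({u j, u (j + 1)} : Set Pt) ∈ F i}.ncard = 3) ∧
      TriangleFree (⋃ i, F i) := by
  obtain ⟨ρ, θ, hρ, hu⟩ := hw
  have hue := wheel_eq n hn x u ρ θ hu
  obtain ⟨p, q, r, t, hg⟩ := good_exists n k hn hk
  obtain ⟨hp, hq, hr, hm⟩ := good_pos hg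
  have hm0 : (0 : ℤ) < 2 * n - 1 := by omega
  have hx : ∀ z, cpt x ρ θ (2 * n - 1) z ≠ x := fun z => cpt_ne x ρ θ hρ _ z
  have hP : ∀ y z, cpt x ρ θ (2 * n - 1) y = cpt x ρ θ (2 * n - 1) z ↔ (2 * n - 1 : ℤ) ∣ y - z := by
    intro y z
    refine ⟨cpt_inj x ρ θ hρ _ y z hm0, ?_⟩
    rintro ⟨c, hc⟩
    obtain rfl : y = z + (2 * n - 1) * c := by linarith
    exact cpt_periodic _ _ _ _ _ _ hm0
  have hsurj : ∀ j : ZMod (2 * n - 1), ∃ z : ℤ, (z : ZMod (2 * n - 1)) = j :=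
    ZMod.intCast_surjective
  have hrange : Set.range u = Set.range (cpt x ρ θ (2 * n - 1)) := by
    ext y
    constructor
    · rintro ⟨j, rfl⟩
      obtain ⟨z, rfl⟩ := hsurj j
      exact ⟨z, (hue z).symm⟩
    · rintro ⟨z, rfl⟩
      exact ⟨z, hue z⟩
  have hcast : ∀ y z : ℤ, (y : ZMod (2 * n - 1)) = (z : ZMod (2 * n - 1)) ↔
      (2 * n - 1 : ℤ) ∣ y - z := by
    intro y z
    have e : (2 * n - 1 : ℤ) = ((2 * n - 1 : ℕ) : ℤ) := by omega
    rw [e, eq_comm, ZMod.intCast_eq_intCast_iff_dvd_sub]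
  refine ⟨fun i => MM x (cpt x ρ θ (2 * n - 1)) p q r (2 * (i : ℕ)), ?_, ?_, ?_, ?_, ?_⟩
  · intro i
    rw [hrange]
    exact MM_perfect hP hx hg _
  · intro i
    exact MM_noncross x ρ θ hρ hg _
  · intro i j hij
    refine MM_disj hP hx hg _ _ (by omega) (by omega) (by omega) (by omega) ?_
    intro h
    exact hij (Fin.ext (by exact_mod_cast h))
  · intro i
    have hset : {j : ZMod (2 * n - 1) | ({u j, u (j + 1)} : Set Pt) ∈
        MM x (cpt x ρ θ (2 * n - 1)) p q r (2 * (i : ℕ))} =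
        {((2 * (i : ℕ) + p : ℤ) : ZMod (2 * n - 1)),
         ((2 * (i : ℕ) + (2 * p + q) : ℤ) : ZMod (2 * n - 1)),
         ((2 * (i : ℕ) + (2 * p + 2 * q + r) : ℤ) : ZMod (2 * n - 1))} := by
      ext j
      obtain ⟨z, rfl⟩ := hsurj j
      have h1 : ((z : ZMod (2 * n - 1)) + 1) = ((z + 1 : ℤ) : ZMod (2 * n - 1)) := by push_cast; rfl
      simp only [Set.mem_ofPred_eq, Set.mem_insert_iff, Set.mem_singleton_iff]
      rw [h1, hue, hue, MM_bdry hP hx hg, hcast, hcast, hcast]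
    rw [hset, Set.ncard_eq_three]
    refine ⟨_, _, _, ?_, ?_, ?_, rfl⟩
    all_goals
      rw [Ne, hcast]
      rintro ⟨c, hc⟩
      have := small_mult (by omega) (by omega) hc
      omega
  · apply MM_tri hP hx hg
    intro e he
    obtain ⟨i, hi⟩ := Set.mem_iUnion.1 he
    exact ⟨((i : ℕ) : ℤ), by omega, by omega, hi⟩
end
end
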